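/- Let p be a core (I,J)-coset and let s ∈ S∖I satisfy ℓ(s·p̄) < ℓ(p̄). Then there exist m ≥ 1 and a reduced atomic expression (L_0,…,L_m; s_1,…,s_m) from I to J with first letter s_1 = s and with x_m = p̄, i.e. expressing p. -/

import Mathlib

namespace CoxeterAtoms

variable {B : Type*} {W : Type*} [Group W] {M : CoxeterMatrix B}

/-- The standard parabolic subgroup `W_K` generated by the simple reflections indexed by `K`. -/
def par (cs : CoxeterSystem M W) (K : Set B) : Subgroup W :=
  Subgroup.closure (cs.simple '' K)

/-- `K` is finitary if `W_K` is finite. -/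
def Finitary (cs : CoxeterSystem M W) (K : Set B) : Prop :=
  ((par cs K : Set W)).Finite

/-- The left coset `W_I · x`. -/
def lcos (cs : CoxeterSystem M W) (I : Set B) (x : W) : Set W :=
  {w | ∃ a ∈ par cs I, w = a * x}

/-- The right coset `x · W_J`. -/
def rcos (cs : CoxeterSystem M W) (x : W) (J : Set B) : Set W :=
  {w | ∃ b ∈ par cs J, w = x * b}

/-- The double coset `W_I · x · W_J`. -/
def dcos (cs : CoxeterSystem M W) (I : Set B) (x : W) (J : Set B) : Set W :=
  {w | ∃ a ∈ par cs I, ∃ b ∈ par cs J, w = a * x * b}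

/-- `x` is a minimal length element of its double coset `W_I · x · W_J`. -/
def IsMinRep (cs : CoxeterSystem M W) (I : Set B) (x : W) (J : Set B) : Prop :=
  ∀ w ∈ dcos cs I x J, cs.length x ≤ cs.length w

/-- `y` is a maximal length element of the set `p`. -/
def IsMaxOf (cs : CoxeterSystem M W) (p : Set W) (y : W) : Prop :=
  y ∈ p ∧ ∀ w ∈ p, cs.length w ≤ cs.length y

/-- `y` is the longest element of the standard parabolic subgroup `W_K`. -/
def IsLongest (cs : CoxeterSystem M W) (K : Set B) (y : W) : Prop :=
  y ∈ par cs K ∧ ∀ w ∈ par cs K, cs.length w ≤ cs.length y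

/-- The double coset `W_I · x · W_J` is core: `W_I·x = W_I·x·W_J = x·W_J`. -/
def IsCore (cs : CoxeterSystem M W) (I : Set B) (x : W) (J : Set B) : Prop :=
  lcos cs I x = dcos cs I x J ∧ dcos cs I x J = rcos cs x J

/-- A reduced atomic expression `(L_0,…,L_m; s_1,…,s_m)` of width `m` from `I` to `J`,
together with the associated data: the removed letters `t_i`, the longest elements
`w_{L_i}` and `w_{K_i}` (where `K_i = L_{i-1} ∪ {s_i}`), and the partial products `x_i`. -/
structure RAtomExpr (cs : CoxeterSystem M W) (I J : Set B) (m : ℕ) where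
  Lset : ℕ → Set B
  letter : ℕ → B
  tletter : ℕ → B
  wL : ℕ → W
  wK : ℕ → W
  x : ℕ → W
  hL0 : Lset 0 = I
  hLm : Lset m = J
  hwL : ∀ i ≤ m, IsLongest cs (Lset i) (wL i)
  hmem : ∀ i, 1 ≤ i → i ≤ m → letter i ∉ Lset (i - 1)
  hfinK : ∀ i, 1 ≤ i → i ≤ m → Finitary cs (Lset (i - 1) ∪ {letter i})
  hwK : ∀ i, 1 ≤ i → i ≤ m → IsLongest cs (Lset (i - 1) ∪ {letter i}) (wK i)
  ht : ∀ i, 1 ≤ i → i ≤ m →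
    cs.simple (tletter i) = wK i * cs.simple (letter i) * wK i
  hLi : ∀ i, 1 ≤ i → i ≤ m → Lset i = (Lset (i - 1) ∪ {letter i}) \ {tletter i}
  hx0 : x 0 = wL 0
  hx : ∀ i, 1 ≤ i → i ≤ m → x i = x (i - 1) * wL (i - 1) * wK i
  hred : ∀ i, 1 ≤ i → i ≤ m →
    (cs.length (x i) : ℤ) =
      (cs.length (x (i - 1)) : ℤ) - cs.length (wL (i - 1)) + cs.length (wK i)

/-! ### Injectivity of simple reflections, via the geometric representation -/

noncomputable def corootFn (M : CoxeterMatrix B) (i : B) : Module.Dual ℝ (B →₀ ℝ) :=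
  Finsupp.linearCombination ℝ (fun j => -2 * Real.cos (Real.pi / (M i j : ℝ)))

lemma corootFn_single (M : CoxeterMatrix B) (i j : B) :
    corootFn M i (Finsupp.single j 1) = -2 * Real.cos (Real.pi / (M i j : ℝ)) := by
  simp [corootFn]

lemma corootFn_self (M : CoxeterMatrix B) (i : B) :
    corootFn M i (Finsupp.single i 1) = 2 := by
  rw [corootFn_single, M.diagonal]; simp

lemma geom_rel (M : CoxeterMatrix B) (i j : B) (hij : i ≠ j) :
    (Module.reflection (corootFn_self M i) * Module.reflection (corootFn_self M j)) ^ M i j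
      = 1 := by
  have h1 := M.off_diagonal i j hij
  have hs : M j i = M i j := M.symmetric j i
  refine LinearEquiv.ext fun z => ?_
  generalize hm : M i j = m at *
  have key := Module.reflection_mul_reflection_pow_apply (corootFn_self M i) (corootFn_self M j) m z
    (2 * Real.cos (2 * (Real.pi / m))) (by
      rw [corootFn_single, corootFn_single, hs, hm, Real.cos_two_mul]; ring)
  rcases Nat.lt_or_ge m 3 with h3 | h3
  · interval_cases m
    · simp
    · omega
    · have e1 : corootFn M i (Finsupp.single j 1) = 0 := by
        rw [corootFn_single, hm]; simp
      have e2 : corootFn M j (Finsupp.single i 1) = 0 := by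
        rw [corootFn_single, hs]; simp
      rw [pow_two]
      simp only [LinearEquiv.mul_apply, Module.reflection_apply, map_sub, map_smul, e1, e2,
        corootFn_self, LinearEquiv.coe_one, id]
      module
  · rw [key]
    set θ : ℝ := 2 * (Real.pi / m) with hθ
    have hm0 : (0 : ℝ) < m := by positivity
    have hm3 : (3 : ℝ) ≤ m := by exact_mod_cast h3
    have hmθ : m * θ = 2 * Real.pi := by rw [hθ]; field_simp
    have hsin : Real.sin θ ≠ 0 := by
      apply ne_of_gt
      apply Real.sin_pos_of_pos_of_lt_pi
      · rw [hθ]; positivity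
      · nlinarith [Real.pi_pos]
    have hS := fun n : ℤ => Polynomial.Chebyshev.S_two_mul_real_cos θ n
    rcases Nat.even_or_odd' m with ⟨k, hk | hk⟩
    · have a1 : ((m : ℤ) - 2) / 2 = k - 1 := by omega
      have a2 : ((m : ℤ) - 1) / 2 = k - 1 := by omega
      have z1 : (Polynomial.Chebyshev.S ℝ ((k : ℤ) - 1)).eval (2 * Real.cos θ) = 0 := by
        have := hS (k - 1)
        have e : (((k : ℤ) - 1 : ℤ) + 1 : ℝ) * θ = Real.pi := by
          have : (m : ℝ) = 2 * k := by exact_mod_cast hk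
          push_cast; rw [this] at hmθ; linarith
        rw [e, Real.sin_pi] at this
        exact (mul_eq_zero.mp this).resolve_right hsin
      rw [a1, a2, z1]; simp
    · have a1 : ((m : ℤ) - 2) / 2 = k - 1 := by omega
      have a2 : ((m : ℤ) - 1) / 2 = k := by omega
      have a3 : ((m : ℤ) - 3) / 2 = k - 1 := by omega
      have a4 : ((m : ℤ)) / 2 = k := by omega
      have z1 : (Polynomial.Chebyshev.S ℝ (k : ℤ)).eval (2 * Real.cos θ)
          + (Polynomial.Chebyshev.S ℝ ((k : ℤ) - 1)).eval (2 * Real.cos θ) = 0 := by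
        have h1 := hS (k - 1)
        have h2 := hS k
        have e : (((k : ℤ) : ℝ) + 1) * θ = 2 * Real.pi - (((k : ℤ) - 1 : ℤ) + 1 : ℝ) * θ := by
          have : (m : ℝ) = 2 * k + 1 := by exact_mod_cast hk
          push_cast; rw [this] at hmθ; linarith
        rw [e, Real.sin_two_pi_sub] at h2
        have : ((Polynomial.Chebyshev.S ℝ (k : ℤ)).eval (2 * Real.cos θ)
          + (Polynomial.Chebyshev.S ℝ ((k : ℤ) - 1)).eval (2 * Real.cos θ)) * Real.sin θ = 0 := by
          rw [add_mul, h1, h2]; ring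
        exact (mul_eq_zero.mp this).resolve_right hsin
      rw [a1, a2, a3, a4, z1]; simp

lemma geom_liftable (M : CoxeterMatrix B) :
    M.IsLiftable (fun i => Module.reflection (corootFn_self M i)) := by
  intro i j
  by_cases h : i = j
  · subst h
    rw [M.diagonal, pow_one]
    refine LinearEquiv.ext fun z => ?_
    rw [LinearEquiv.mul_apply]
    exact Module.involutive_reflection (corootFn_self M i) z
  · exact geom_rel M i j h

lemma simple_inj (cs : CoxeterSystem M W) {i j : B} (h : cs.simple i = cs.simple j) : i = j := by
  by_contra hij
  have h' := congrArg (cs.lift ⟨_, geom_liftable M⟩) h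
  rw [cs.lift_apply_simple, cs.lift_apply_simple] at h'
  have h2 := congrArg (fun g => (g (Finsupp.single i 1)) i) h'
  simp only [Module.reflection_apply, corootFn_self] at h2
  simp [Ne.symm hij] at h2

/-! ### The exchange property -/

open Classical in
/-- Indicator function with values in `ZMod 2`. -/
noncomputable def ind (a b : W) : ZMod 2 := if a = b then 1 else 0

lemma ind_congr {a b c d : W} (h : a = b ↔ c = d) : ind a b = ind c d := by
  unfold ind
  by_cases h' : a = b
  · rw [if_pos h', if_pos (h.mp h')]
  · rw [if_neg h', if_neg (fun x => h' (h.mpr x))]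

lemma zmod2_add_self (a : ZMod 2) : a + a = 0 := CharTwo.add_self_eq_zero a

/-- The action of a simple reflection on signed group elements. -/
noncomputable def signFun (cs : CoxeterSystem M W) (i : B) : Function.End (W × ZMod 2) :=
  fun p => (cs.simple i * p.1 * cs.simple i, p.2 + ind p.1 (cs.simple i))

lemma signFun_pow (cs : CoxeterSystem M W) (i j : B) (n : ℕ) (t : W) (e : ZMod 2) :
    ((signFun cs i * signFun cs j) ^ n) (t, e) =
      ((cs.simple i * cs.simple j) ^ n * t * ((cs.simple i * cs.simple j) ^ n)⁻¹,
        e + ∑ k ∈ Finset.range (2 * n), ind t (cs.simple j * (cs.simple i * cs.simple j) ^ k)) := by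
  set r := cs.simple i * cs.simple j with hr
  have hrj : ∀ n : ℕ, cs.simple j * r ^ n = (r ^ n)⁻¹ * cs.simple j := by
    intro n
    induction n with
    | zero => simp
    | succ n ih =>
      have : cs.simple j * r = r⁻¹ * cs.simple j := by
        rw [hr]; simp [mul_assoc]
      rw [pow_succ, ← mul_assoc, ih, mul_assoc, this, ← mul_assoc, ← mul_inv_rev r (r ^ n),
        ← pow_succ', ← pow_succ]
  induction n with
  | zero => simp; rfl
  | succ n ih =>
    rw [pow_succ']
    show (signFun cs i) ((signFun cs j) (((signFun cs i * signFun cs j) ^ n) (t, e))) = _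
    rw [ih]
    simp only [signFun]
    ext
    · simp only [pow_succ', hr]
      simp [mul_assoc]
    · simp only
      rw [show 2 * (n + 1) = 2 * n + 1 + 1 by ring, Finset.sum_range_succ, Finset.sum_range_succ,
        ← add_assoc, ← add_assoc]
      congr 1
      · congr 1
        apply ind_congr
        rw [two_mul, pow_add, ← mul_assoc, hrj]
        rw [mul_inv_eq_iff_eq_mul, ← eq_inv_mul_iff_mul_eq, mul_assoc]
      · apply ind_congr
        rw [two_mul, pow_succ, pow_add]
        rw [show cs.simple j * (r ^ n * r ^ n * r) = (cs.simple j * r ^ n) * (r ^ n * r) by group,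
          hrj, ← pow_succ, pow_succ', hr]
        constructor
        · intro h
          have : t = (r ^ n)⁻¹ * cs.simple j * cs.simple i * cs.simple j * r ^ n := by
            rw [← hr] at h
            rw [← h]
            simp [mul_assoc]
          rw [this]; simp [mul_assoc, hr]
        · intro h
          rw [h]
          simp [mul_assoc, hr]

lemma signFun_liftable (cs : CoxeterSystem M W) : M.IsLiftable (signFun cs) := by
  intro i j
  funext p
  obtain ⟨t, e⟩ := p
  rw [signFun_pow, cs.simple_mul_simple_pow, two_mul, Finset.sum_range_add]
  simp only [pow_add, cs.simple_mul_simple_pow, one_mul]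
  rw [zmod2_add_self]
  simp
  rfl

/-- The reflection cocycle action. -/
noncomputable def signHom (cs : CoxeterSystem M W) : W →* Function.End (W × ZMod 2) :=
  cs.lift ⟨signFun cs, signFun_liftable cs⟩

lemma signHom_simple (cs : CoxeterSystem M W) (i : B) :
    signHom cs (cs.simple i) = signFun cs i := cs.lift_apply_simple _ i

lemma signHom_word (cs : CoxeterSystem M W) (ω : List B) (t : W) :
    ∃ c : ZMod 2, (∀ e, signHom cs (cs.wordProd ω) (t, e) =
      (cs.wordProd ω * t * (cs.wordProd ω)⁻¹, e + c)) ∧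
      (c = 0 ∨ ∃ ω₁ i ω₂, ω = ω₁ ++ i :: ω₂ ∧ cs.wordProd ω * t = cs.wordProd (ω₁ ++ ω₂)) := by
  induction ω with
  | nil =>
    refine ⟨0, ?_, Or.inl rfl⟩
    intro e
    simp
    rfl
  | cons i ω ih =>
    obtain ⟨c, hc, hex⟩ := ih
    refine ⟨c + ind (cs.wordProd ω * t * (cs.wordProd ω)⁻¹) (cs.simple i), ?_, ?_⟩
    · intro e
      rw [cs.wordProd_cons, map_mul]
      show (signHom cs (cs.simple i)) (signHom cs (cs.wordProd ω) (t, e)) = _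
      rw [hc, signHom_simple]
      simp [signFun, mul_assoc, add_assoc]
    · by_cases h : cs.wordProd ω * t * (cs.wordProd ω)⁻¹ = cs.simple i
      · right
        refine ⟨[], i, ω, rfl, ?_⟩
        rw [mul_inv_eq_iff_eq_mul] at h
        rw [cs.wordProd_cons, mul_assoc, h]
        simp
      · rcases hex with h0 | ⟨ω₁, j, ω₂, e1, e2⟩
        · left; simp [h0, ind, h]
        · right
          refine ⟨i :: ω₁, j, ω₂, by simp [e1], ?_⟩
          rw [cs.wordProd_cons, mul_assoc, e2, List.cons_append, cs.wordProd_cons]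

lemma exchange_right (cs : CoxeterSystem M W) (ω : List B) (i : B)
    (h : cs.length (cs.wordProd ω * cs.simple i) < cs.length (cs.wordProd ω)) :
    ∃ ω₁ j ω₂, ω = ω₁ ++ j :: ω₂ ∧ cs.wordProd ω * cs.simple i = cs.wordProd (ω₁ ++ ω₂) := by
  obtain ⟨c, hc, hex⟩ := signHom_word cs ω (cs.simple i)
  rcases hex with h0 | hex
  swap
  · exact hex
  exfalso
  subst h0
  obtain ⟨τ, hτ, e⟩ := cs.exists_isReduced (cs.wordProd ω * cs.simple i)
  obtain ⟨d, hd, hex⟩ := signHom_word cs τ (cs.simple i)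
  have h1 := hd 0
  rw [← e, map_mul] at h1
  have h2 : (signHom cs (cs.wordProd ω)) (signHom cs (cs.simple i) (cs.simple i, 0)) = _ := h1
  rw [signHom_simple] at h2
  simp only [signFun, cs.simple_mul_simple_self, one_mul] at h2
  rw [hc] at h2
  have h3 := congrArg Prod.snd h2
  simp only [ind, if_true] at h3
  rcases hex with h0 | ⟨ω₁, j, ω₂, e1, e2⟩
  · rw [h0] at h3; simp at h3
  · rw [← e] at e2
    have l1 : cs.length (cs.wordProd ω) ≤ (ω₁ ++ ω₂).length := by
      have := cs.length_wordProd_le (ω₁ ++ ω₂)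
      rw [← e2] at this
      simpa using this
    have l2 := hτ.eq
    rw [← e, e1] at l2
    simp at l1 l2
    omega

lemma exchange_left (cs : CoxeterSystem M W) (ω : List B) (i : B)
    (h : cs.length (cs.simple i * cs.wordProd ω) < cs.length (cs.wordProd ω)) :
    ∃ ω₁ j ω₂, ω = ω₁ ++ j :: ω₂ ∧ cs.simple i * cs.wordProd ω = cs.wordProd (ω₁ ++ ω₂) := by
  have h' : cs.length (cs.wordProd ω.reverse * cs.simple i) < cs.length (cs.wordProd ω.reverse) := by
    rw [cs.wordProd_reverse, cs.length_inv, ← cs.length_inv]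
    simpa using h
  obtain ⟨ω₁, j, ω₂, e1, e2⟩ := exchange_right cs _ i h'
  refine ⟨ω₂.reverse, j, ω₁.reverse, ?_, ?_⟩
  · rw [← List.reverse_reverse ω, e1]; simp
  · have := congrArg (·⁻¹) e2
    simp only [cs.wordProd_reverse, mul_inv_rev, inv_inv, cs.inv_simple] at this
    rw [this, ← cs.wordProd_reverse]; simp

/-! ### Parabolic subgroups -/

lemma simple_mem_par (cs : CoxeterSystem M W) {K : Set B} {k : B} (hk : k ∈ K) :
    cs.simple k ∈ par cs K := Subgroup.subset_closure ⟨k, hk, rfl⟩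

lemma par_mono (cs : CoxeterSystem M W) {I K : Set B} (h : I ⊆ K) : par cs I ≤ par cs K :=
  Subgroup.closure_mono (Set.image_mono h)

lemma wordProd_mem_par (cs : CoxeterSystem M W) {K : Set B} (ω : List B) (h : ∀ i ∈ ω, i ∈ K) :
    cs.wordProd ω ∈ par cs K := by
  induction ω with
  | nil => simp [one_mem]
  | cons i ω ih =>
    rw [cs.wordProd_cons]
    exact mul_mem (simple_mem_par cs (h i (by simp))) (ih fun j hj => h j (by simp [hj]))

lemma par_word (cs : CoxeterSystem M W) {K : Set B} {b : W} (hb : b ∈ par cs K) :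
    ∃ ω : List B, (∀ i ∈ ω, i ∈ K) ∧ cs.IsReduced ω ∧ cs.wordProd ω = b := by
  have step : ∀ (k : B) (x : W), k ∈ K →
      (∃ ω : List B, (∀ i ∈ ω, i ∈ K) ∧ cs.IsReduced ω ∧ cs.wordProd ω = x) →
      ∃ ω : List B, (∀ i ∈ ω, i ∈ K) ∧ cs.IsReduced ω ∧ cs.wordProd ω = cs.simple k * x := by
    rintro k x hk ⟨ω, h1, h2, rfl⟩
    have h2' := h2.eq
    rcases cs.length_simple_mul (cs.wordProd ω) k with h | h
    · refine ⟨k :: ω, ?_, ?_, cs.wordProd_cons k ω⟩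
      · intro i hi
        rcases List.mem_cons.mp hi with rfl | hi
        · exact hk
        · exact h1 i hi
      · unfold CoxeterSystem.IsReduced
        rw [cs.wordProd_cons, h, h2', List.length_cons]
    · obtain ⟨ω₁, j, ω₂, e1, e2⟩ := exchange_left cs ω k (by omega)
      refine ⟨ω₁ ++ ω₂, ?_, ?_, e2.symm⟩
      · intro i hi
        apply h1
        rw [e1]
        simp only [List.mem_append, List.mem_cons] at hi ⊢
        tauto
      · unfold CoxeterSystem.IsReduced
        rw [← e2]
        have e3 := congrArg List.length e1
        simp at e3 ⊢
        omega
  induction hb using Subgroup.closure_induction_left with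
  | one => exact ⟨[], by simp, by simp [CoxeterSystem.IsReduced], by simp⟩
  | mul_left x hx y hy ih =>
    obtain ⟨k, hk, rfl⟩ := hx
    exact step k y hk ih
  | inv_mul_cancel x hx y hy ih =>
    obtain ⟨k, hk, rfl⟩ := hx
    rw [cs.inv_simple]
    exact step k y hk ih

lemma mem_of_simple_mem_par (cs : CoxeterSystem M W) {K : Set B} {k : B}
    (h : cs.simple k ∈ par cs K) : k ∈ K := by
  obtain ⟨ω, h1, h2, h3⟩ := par_word cs h
  have h4 := h2.eq
  rw [h3, cs.length_simple] at h4
  obtain ⟨j, rfl⟩ := List.length_eq_one_iff.mp h4.symm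
  rw [cs.wordProd_singleton] at h3
  rw [← simple_inj cs h3]
  exact h1 j (by simp)

lemma par_inj (cs : CoxeterSystem M W) {I J : Set B} (h : par cs I = par cs J) : I = J := by
  ext k
  constructor
  · intro hk; exact mem_of_simple_mem_par cs (h ▸ simple_mem_par cs hk)
  · intro hk; exact mem_of_simple_mem_par cs (h ▸ simple_mem_par cs hk)

/-- If `s` is not in `I` then left multiplication by `s` increases lengths on `W_I`. -/
lemma length_simple_mul_of_not_mem (cs : CoxeterSystem M W) {I : Set B} {s : B} (hs : s ∉ I)
    {a : W} (ha : a ∈ par cs I) : cs.length (cs.simple s * a) = cs.length a + 1 := by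
  rcases cs.length_simple_mul a s with h | h
  · exact h
  exfalso
  obtain ⟨ω, h1, h2, rfl⟩ := par_word cs ha
  obtain ⟨ω₁, j, ω₂, e1, e2⟩ := exchange_left cs ω s (by omega)
  apply hs
  apply mem_of_simple_mem_par cs
  have : cs.simple s * cs.wordProd ω ∈ par cs I := by
    rw [e2]
    apply wordProd_mem_par
    intro i hi
    apply h1
    rw [e1]
    simp only [List.mem_append, List.mem_cons] at hi ⊢
    tauto
  exact (Subgroup.mul_mem_cancel_right _ ha).mp this

lemma exchange_initial (cs : CoxeterSystem M W) (b c : W) (s : B)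
    (h1 : cs.length (b * c) = cs.length b + cs.length c)
    (h2 : cs.length (cs.simple s * (b * c)) < cs.length (b * c))
    (h3 : cs.length (cs.simple s * b) = cs.length b + 1) :
    cs.length (b⁻¹ * (cs.simple s * (b * c))) + 1 ≤ cs.length c := by
  obtain ⟨β, hβ, rfl⟩ := cs.exists_isReduced b
  obtain ⟨γ, hγ, rfl⟩ := cs.exists_isReduced c
  have hβ' := hβ.eq
  have hγ' := hγ.eq
  rw [← cs.wordProd_append] at h2
  obtain ⟨ω₁, j, ω₂, e1, e2⟩ := exchange_left cs _ s h2
  rcases List.append_eq_append_iff.mp e1 with ⟨l, e3, e4⟩ | ⟨l, e3, e4⟩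
  · -- deletion in `γ`
    have : (cs.wordProd β)⁻¹ * (cs.simple s * (cs.wordProd β * cs.wordProd γ)) =
        cs.wordProd (l ++ ω₂) := by
      rw [← cs.wordProd_append, e2, e3, List.append_assoc, cs.wordProd_append β]
      simp
    rw [this, hγ', e4]
    have := cs.length_wordProd_le (l ++ ω₂)
    simp at this ⊢
    omega
  · rcases l with _ | ⟨j', l⟩
    · simp at e3 e4
      have : (cs.wordProd β)⁻¹ * (cs.simple s * (cs.wordProd β * cs.wordProd γ)) =
          cs.wordProd ω₂ := by
        rw [← cs.wordProd_append, e2, e3, cs.wordProd_append]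
        simp
      rw [this, hγ', ← e4]
      have := cs.length_wordProd_le ω₂
      simp
      omega
    · simp at e4
      obtain ⟨rfl, rfl⟩ := e4
      exfalso
      rw [← List.append_assoc, cs.wordProd_append, cs.wordProd_append, ← mul_assoc] at e2
      have e5 := mul_right_cancel e2
      rw [e5, hβ', e3] at h3
      have := cs.length_wordProd_le (ω₁ ++ l)
      simp at h3 this
      omega

/-- If all elements of `K` are left descents of `w`, all elements of `W_K` are prefixes. -/
lemma initial_of_descents (cs : CoxeterSystem M W) {K : Set B} {w : W}
    (hw : ∀ k ∈ K, cs.length (cs.simple k * w) < cs.length w) {b : W} (hb : b ∈ par cs K) :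
    cs.length w = cs.length b + cs.length (b⁻¹ * w) := by
  obtain ⟨ω, h1, h2, rfl⟩ := par_word cs hb
  clear hb
  induction ω with
  | nil => simp
  | cons k ω ih =>
    have hred : cs.IsReduced ω := by simpa using h2.drop 1
    have ih' := ih (fun i hi => h1 i (by simp [hi])) hred
    have e1 := h2.eq
    have e2 := hred.eq
    rw [cs.wordProd_cons] at e1 ⊢
    simp at e1
    have key := exchange_initial cs (cs.wordProd ω) ((cs.wordProd ω)⁻¹ * w) k
      (by simpa using ih') (by simpa using hw k (h1 k (by simp))) (by omega)
    have tri := cs.length_mul_le (cs.simple k * cs.wordProd ω)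
      ((cs.simple k * cs.wordProd ω)⁻¹ * w)
    simp [mul_assoc] at key tri ⊢
    omega

lemma finitary_finite (cs : CoxeterSystem M W) {I : Set B} (h : Finitary cs I) : I.Finite := by
  apply Set.Finite.of_injOn (f := cs.simple) (t := (par cs I : Set W)) _ _ h
  · intro i hi; exact simple_mem_par cs hi
  · intro i _ j _ hij; exact simple_inj cs hij

lemma finitary_of_descents (cs : CoxeterSystem M W) {K : Set B} (hK : K.Finite) {w : W}
    (hw : ∀ k ∈ K, cs.length (cs.simple k * w) < cs.length w) : Finitary cs K := by
  have : Finite K := hK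
  have fin : {l : List K | l.length ≤ cs.length w}.Finite := List.finite_length_le K _
  apply (fin.image (fun l => cs.wordProd (l.map Subtype.val))).subset
  intro b hb
  have h := initial_of_descents cs hw hb
  obtain ⟨ω, h1, h2, rfl⟩ := par_word cs hb
  have h2' := h2.eq
  refine ⟨ω.attachWith _ h1, ?_, ?_⟩
  · simp; omega
  · simp

lemma exists_longest (cs : CoxeterSystem M W) {K : Set B} (hK : Finitary cs K) :
    ∃ y, IsLongest cs K y := by
  obtain ⟨y, hy, h⟩ := Set.exists_max_image _ cs.length hK ⟨1, one_mem _⟩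
  exact ⟨y, hy, h⟩

section longest
variable {cs : CoxeterSystem M W} {K : Set B} {y : W}

lemma IsLongest.desc (h : IsLongest cs K y) : ∀ k ∈ K, cs.length (cs.simple k * y) < cs.length y := by
  intro k hk
  have := h.2 _ (mul_mem (simple_mem_par cs hk) h.1)
  have := cs.length_simple_mul_ne y k
  omega

lemma IsLongest.unique {y' : W} (h : IsLongest cs K y) (h' : IsLongest cs K y') : y = y' := by
  have h1 := initial_of_descents cs h.desc h'.1
  have h2 := h.2 _ h'.1
  have h3 := h'.2 _ h.1
  have : cs.length (y'⁻¹ * y) = 0 := by omega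
  rw [cs.length_eq_zero_iff] at this
  exact (inv_mul_eq_one.mp this).symm

lemma IsLongest.inv (h : IsLongest cs K y) : IsLongest cs K y⁻¹ :=
  ⟨inv_mem h.1, fun w hw => by rw [cs.length_inv]; exact h.2 w hw⟩

lemma IsLongest.inv_eq (h : IsLongest cs K y) : y⁻¹ = y := h.inv.unique h

lemma IsLongest.mul_self (h : IsLongest cs K y) : y * y = 1 := by
  nth_rw 1 [← h.inv_eq]; simp

lemma IsLongest.length_mul_left (h : IsLongest cs K y) {b : W} (hb : b ∈ par cs K) :
    cs.length (b * y) + cs.length b = cs.length y := by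
  have := initial_of_descents cs h.desc (inv_mem hb)
  rw [cs.length_inv, inv_inv] at this
  omega

lemma IsLongest.length_mul_right (h : IsLongest cs K y) {b : W} (hb : b ∈ par cs K) :
    cs.length (y * b) + cs.length b = cs.length y := by
  have := h.length_mul_left (inv_mem hb)
  rw [cs.length_inv b] at this
  rw [← cs.length_inv (y * b), mul_inv_rev, h.inv_eq]
  exact this

lemma IsLongest.length_conj (h : IsLongest cs K y) {b : W} (hb : b ∈ par cs K) :
    cs.length (y * b * y) = cs.length b := by
  have h1 := h.length_mul_right hb
  have h2 := h.length_mul_left (mul_mem h.1 hb)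
  omega

lemma IsLongest.conj_mem (h : IsLongest cs K y) {b : W} (hb : b ∈ par cs K) :
    y * b * y ∈ par cs K := mul_mem (mul_mem h.1 hb) h.1

/-- If `K` consists of descents of `w`, then `y * w` is minimal in its coset. -/
lemma IsLongest.min_coset (h : IsLongest cs K y) {w : W}
    (hw : ∀ k ∈ K, cs.length (cs.simple k * w) < cs.length w) {a : W} (ha : a ∈ par cs K) :
    cs.length (a * (y * w)) = cs.length a + cs.length (y * w) := by
  have h1 := initial_of_descents cs hw h.1
  have h2 := initial_of_descents cs hw (mul_mem h.1 (inv_mem ha))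
  have h3 := h.length_mul_right (inv_mem ha)
  rw [h.inv_eq] at h1
  rw [mul_inv_rev, inv_inv, h.inv_eq, mul_assoc] at h2
  rw [cs.length_inv] at h3
  omega

end longest

/-! ### Building atomic expressions -/

lemma conj_par (cs : CoxeterSystem M W) {I L : Set B} {g : W} (hg : g * g = 1)
    (h : ∀ i ∈ I, g * cs.simple i * g ∈ par cs L) {a : W} (ha : a ∈ par cs I) :
    g * a * g ∈ par cs L := by
  induction ha using Subgroup.closure_induction with
  | mem x hx => obtain ⟨i, hi, rfl⟩ := hx; exact h i hi
  | one => rw [mul_one, hg]; exact one_mem _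
  | mul x y _ _ hx hy =>
    have : g * (x * y) * g = (g * x * g) * (g * y * g) := by
      calc g * (x * y) * g = g * x * 1 * y * g := by group
        _ = _ := by rw [← hg]; group
    rw [this]; exact mul_mem hx hy
  | inv x _ hx =>
    have hgi : g⁻¹ = g := inv_eq_of_mul_eq_one_right hg
    have : g * x⁻¹ * g = (g * x * g)⁻¹ := by
      simp [hgi, mul_assoc]
    rw [this]; exact inv_mem hx

lemma cons_expr (cs : CoxeterSystem M W) {I L J : Set B} {s t : B} {wI wK wL p q : W}
    (hwI : IsLongest cs I wI) (hs : s ∉ I) (hK : Finitary cs (I ∪ {s}))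
    (hwK : IsLongest cs (I ∪ {s}) wK) (ht : cs.simple t = wK * cs.simple s * wK)
    (hL : L = (I ∪ {s}) \ {t}) (hwL : IsLongest cs L wL)
    (hu : wK * wL * q = p) (hlen : cs.length p = cs.length (wK * wL) + cs.length q)
    (hpI : cs.length p = cs.length wI + cs.length (wI⁻¹ * p))
    {m : ℕ} (E : RAtomExpr cs L J m) (hE : E.x m = q)
    (hpre : ∀ i ≤ m, cs.length q = cs.length (E.x i) + cs.length ((E.x i)⁻¹ * q)) :
    ∃ E' : RAtomExpr cs I J (m + 1), E'.letter 1 = s ∧ E'.x (m + 1) = p ∧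
      ∀ i ≤ m + 1, cs.length p = cs.length (E'.x i) + cs.length ((E'.x i)⁻¹ * p) := by
  have hadd : ∀ i ≤ m, cs.length (wK * wL * E.x i) = cs.length (wK * wL) + cs.length (E.x i) ∧
      cs.length p = cs.length (wK * wL * E.x i) + cs.length ((wK * wL * E.x i)⁻¹ * p) := by
    intro i hi
    have h1 := hpre i hi
    have e : (wK * wL * E.x i)⁻¹ * p = (E.x i)⁻¹ * q := by
      rw [← hu]; group
    have h2 := cs.length_mul_le (wK * wL) (E.x i)
    have h3 := cs.length_mul_le (wK * wL * E.x i) ((wK * wL * E.x i)⁻¹ * p)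
    rw [mul_inv_cancel_left] at h3
    rw [e] at h3 ⊢
    constructor <;> omega
  have hEx0 : E.x 0 = wL := by
    rw [E.hx0]
    have h := E.hwL 0 (Nat.zero_le _)
    rw [E.hL0] at h
    exact h.unique hwL
  have hx1 : wK * wL * E.x 0 = wK := by rw [hEx0, mul_assoc, hwL.mul_self, mul_one]
  refine ⟨{
    Lset := fun i => Nat.casesOn i I E.Lset
    letter := fun i => Nat.casesOn i s (fun j => Nat.casesOn j s (fun k => E.letter (k + 1)))
    tletter := fun i => Nat.casesOn i t (fun j => Nat.casesOn j t (fun k => E.tletter (k + 1)))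
    wL := fun i => Nat.casesOn i wI E.wL
    wK := fun i => Nat.casesOn i wK (fun j => Nat.casesOn j wK (fun k => E.wK (k + 1)))
    x := fun i => Nat.casesOn i wI (fun j => wK * wL * E.x j)
    hL0 := rfl
    hLm := E.hLm
    hwL := ?_
    hmem := ?_
    hfinK := ?_
    hwK := ?_
    ht := ?_
    hLi := ?_
    hx0 := rfl
    hx := ?_
    hred := ?_ }, rfl, ?_, ?_⟩
  · rintro (_ | i) hi
    · exact hwI
    · exact E.hwL i (by omega)
  · rintro (_ | _ | i) h1 hi
    · omega
    · exact hs
    · exact E.hmem (i + 1) (by omega) (by omega)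
  · rintro (_ | _ | i) h1 hi
    · omega
    · exact hK
    · exact E.hfinK (i + 1) (by omega) (by omega)
  · rintro (_ | _ | i) h1 hi
    · omega
    · exact hwK
    · exact E.hwK (i + 1) (by omega) (by omega)
  · rintro (_ | _ | i) h1 hi
    · omega
    · exact ht
    · exact E.ht (i + 1) (by omega) (by omega)
  · rintro (_ | _ | i) h1 hi
    · omega
    · exact E.hL0.trans hL
    · exact E.hLi (i + 1) (by omega) (by omega)
  · rintro (_ | _ | i) h1 hi
    · omega
    · show wK * wL * E.x 0 = wI * wI * wK
      rw [hx1, hwI.mul_self, one_mul]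
    · show wK * wL * E.x (i + 1) = wK * wL * E.x i * E.wL i * E.wK (i + 1)
      have := E.hx (i + 1) (by omega) (by omega)
      rw [this]
      simp [mul_assoc]
  · rintro (_ | _ | i) h1 hi
    · omega
    · show (cs.length (wK * wL * E.x 0) : ℤ) = cs.length wI - cs.length wI + cs.length wK
      rw [hx1]; ring
    · show (cs.length (wK * wL * E.x (i + 1)) : ℤ) =
        cs.length (wK * wL * E.x i) - cs.length (E.wL i) + cs.length (E.wK (i + 1))
      have h := E.hred (i + 1) (by omega) (by omega)
      rw [(hadd (i + 1) (by omega)).1, (hadd i (by omega)).1]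
      simp only [Nat.add_sub_cancel] at h
      push_cast
      omega
  · show wK * wL * E.x m = p
    rw [hE, hu]
  · rintro (_ | i) hi
    · exact hpI
    · exact (hadd i (by omega)).2

/-- `z` is the minimal element of a core `(I,J)`-coset. -/
structure Good (cs : CoxeterSystem M W) (I J : Set B) (z : W) : Prop where
  min : ∀ a ∈ par cs I, cs.length (a * z) = cs.length a + cs.length z
  back : ∀ b ∈ par cs J, z * b * z⁻¹ ∈ par cs I
  len : ∀ b ∈ par cs J, cs.length (z * b * z⁻¹) = cs.length b
  forth : ∀ a ∈ par cs I, z⁻¹ * a * z ∈ par cs J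

lemma good_step (cs : CoxeterSystem M W) {I J : Set B} (hI : Finitary cs I) {wI z : W}
    (hwI : IsLongest cs I wI) (hz : Good cs I J z) {s : B} (hs : s ∉ I)
    (hdes : cs.length (cs.simple s * (wI * z)) < cs.length (wI * z)) :
    ∃ (L : Set B) (wL z' : W), Finitary cs L ∧ IsLongest cs L wL ∧ Good cs L J z' ∧
      cs.length z' < cs.length z ∧
      ∀ (m : ℕ) (E : RAtomExpr cs L J m), E.x m = wL * z' →
        (∀ i ≤ m, cs.length (wL * z') = cs.length (E.x i) + cs.length ((E.x i)⁻¹ * (wL * z'))) →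
        ∃ E' : RAtomExpr cs I J (m + 1), E'.letter 1 = s ∧ E'.x (m + 1) = wI * z ∧
          ∀ i ≤ m + 1, cs.length (wI * z) =
            cs.length (E'.x i) + cs.length ((E'.x i)⁻¹ * (wI * z)) := by
  set K : Set B := I ∪ {s} with hKdef
  have hKd : ∀ k ∈ K, cs.length (cs.simple k * (wI * z)) < cs.length (wI * z) := by
    rintro k (hk | hk)
    · have h1 := hz.min _ (mul_mem (simple_mem_par cs hk) hwI.1)
      have h2 := hz.min _ hwI.1
      have h3 := hwI.desc k hk
      rw [← mul_assoc]
      omega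
    · rw [Set.mem_singleton_iff] at hk
      rw [hk]; exact hdes
  have hKfin : Finitary cs K :=
    finitary_of_descents cs ((finitary_finite cs hI).union (Set.finite_singleton s)) hKd
  obtain ⟨wK, hwK⟩ := exists_longest cs hKfin
  have hsK : s ∈ K := Or.inr rfl
  have hIK : I ⊆ K := Set.subset_union_left
  have conjS : ∀ k ∈ K, ∃ j ∈ K, wK * cs.simple k * wK = cs.simple j := by
    intro k hk
    have h1 := hwK.length_conj (simple_mem_par cs hk)
    rw [cs.length_simple, cs.length_eq_one_iff] at h1
    obtain ⟨j, hj⟩ := h1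
    refine ⟨j, mem_of_simple_mem_par cs ?_, hj⟩
    rw [← hj]
    exact hwK.conj_mem (simple_mem_par cs hk)
  have cc : ∀ x : W, wK * (wK * x * wK) * wK = x := by
    intro x
    calc wK * (wK * x * wK) * wK = (wK * wK) * x * (wK * wK) := by group
      _ = x := by rw [hwK.mul_self]; group
  obtain ⟨t, htK, ht⟩ := conjS s hsK
  set L : Set B := K \ {t} with hLdef
  have hLK : L ⊆ K := Set.sdiff_subset
  have hIL : ∀ a ∈ par cs I, wK * a * wK ∈ par cs L := by
    intro a ha
    refine conj_par cs hwK.mul_self ?_ ha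
    intro i hi
    obtain ⟨j, hjK, hj⟩ := conjS i (hIK hi)
    rw [hj]
    refine simple_mem_par cs ⟨hjK, ?_⟩
    intro hjt
    rw [Set.mem_singleton_iff] at hjt
    subst hjt
    rw [← ht] at hj
    have : i = s := simple_inj cs (mul_left_cancel (mul_right_cancel hj))
    exact hs (this ▸ hi)
  have hLI : ∀ a ∈ par cs L, wK * a * wK ∈ par cs I := by
    intro a ha
    refine conj_par cs hwK.mul_self ?_ ha
    intro i hi
    obtain ⟨j, hjK, hj⟩ := conjS i (hLK hi)
    rw [hj]
    refine simple_mem_par cs ?_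
    rcases hjK with h | h
    · exact h
    · exfalso
      rw [Set.mem_singleton_iff] at h
      subst h
      rw [← hj, cc] at ht
      exact hi.2 (simple_inj cs ht)
  have hwL : IsLongest cs L (wK * wI * wK) := by
    refine ⟨hIL _ hwI.1, ?_⟩
    intro w hw
    rw [hwK.length_conj (par_mono cs hIK hwI.1), ← hwK.length_conj (par_mono cs hLK hw)]
    exact hwI.2 _ (hLI w hw)
  have hLfin : Finitary cs L := Set.Finite.subset hKfin (par_mono cs hLK)
  have hpK : cs.length (wI * z) = cs.length wK + cs.length (wK * (wI * z)) := by
    have := initial_of_descents cs hKd hwK.1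
    rwa [hwK.inv_eq] at this
  have hpI := hz.min _ hwI.1
  have hmin : ∀ a ∈ par cs L, cs.length (a * (wK * (wI * z))) =
      cs.length a + cs.length (wK * (wI * z)) := fun a ha =>
    hwK.min_coset hKd (par_mono cs hLK ha)
  have eback : ∀ b, (wK * (wI * z)) * b * (wK * (wI * z))⁻¹ =
      wK * (wI * (z * b * z⁻¹) * wI) * wK := by
    intro b
    rw [mul_inv_rev, mul_inv_rev, hwK.inv_eq, hwI.inv_eq]; group
  refine ⟨L, wK * wI * wK, wK * (wI * z), hLfin, hwL, ⟨hmin, ?_, ?_, ?_⟩, ?_, ?_⟩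
  · intro b hb
    rw [eback]
    exact hIL _ (hwI.conj_mem (hz.back b hb))
  · intro b hb
    have h1 := hwI.conj_mem (hz.back b hb)
    rw [eback, hwK.length_conj (par_mono cs hIK h1), hwI.length_conj (hz.back b hb), hz.len b hb]
  · intro a ha
    have : (wK * (wI * z))⁻¹ * a * (wK * (wI * z)) = z⁻¹ * (wI * (wK * a * wK) * wI) * z := by
      rw [mul_inv_rev, mul_inv_rev, hwK.inv_eq, hwI.inv_eq]; group
    rw [this]
    exact hz.forth _ (hwI.conj_mem (hLI a ha))
  · have h1 := length_simple_mul_of_not_mem cs hs hwI.1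
    have h2 := hwK.2 _ (mul_mem (simple_mem_par cs hsK) (par_mono cs hIK hwI.1))
    omega
  · intro m E hE hpre
    have e : wK * (wK * wI * wK) * (wK * wI * wK * (wK * (wI * z))) = wI * z := by
      calc _ = wK * ((wK * wI * wK) * (wK * wI * wK)) * (wK * (wI * z)) := by group
        _ = (wK * wK) * (wI * z) := by rw [hwL.mul_self]; group
        _ = _ := by rw [hwK.mul_self, one_mul]
    refine cons_expr cs hwI hs hKfin hwK ht.symm hLdef hwL e ?_ ?_ E hE hpre
    · have h1 := hwK.length_mul_right (par_mono cs hLK hwL.1)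
      have h2 := hmin _ hwL.1
      omega
    · rw [inv_mul_cancel_left]; exact hpI

lemma good_expr (cs : CoxeterSystem M W) {J : Set B} (b₀ : B) (n : ℕ) :
    ∀ (I : Set B) (wI z : W), cs.length z = n → Finitary cs I → IsLongest cs I wI →
      Good cs I J z → ∃ (m : ℕ) (E : RAtomExpr cs I J m), E.x m = wI * z ∧
        ∀ i ≤ m, cs.length (wI * z) = cs.length (E.x i) + cs.length ((E.x i)⁻¹ * (wI * z)) := by
  induction n using Nat.strong_induction_on with
  | _ n ih =>
  intro I wI z hn hI hwI hz
  by_cases h1 : z = 1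
  · subst h1
    have hIJ : I = J := by
      apply par_inj cs
      apply le_antisymm
      · intro a ha; simpa using hz.forth a ha
      · intro a ha; simpa using hz.back a ha
    subst hIJ
    refine ⟨0, ⟨fun _ => I, fun _ => b₀, fun _ => b₀, fun _ => wI, fun _ => wI, fun _ => wI, rfl,
      rfl, fun _ _ => hwI, ?_, ?_, ?_, ?_, ?_, rfl, ?_, ?_⟩, ?_, ?_⟩
    all_goals first | (intro i h1 h2; omega) | simp
  · obtain ⟨s, hs⟩ := cs.exists_leftDescent_of_ne_one h1
    unfold CoxeterSystem.IsLeftDescent at hs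
    have hsI : s ∉ I := by
      intro h
      have := hz.min _ (simple_mem_par cs h)
      omega
    have hdes : cs.length (cs.simple s * (wI * z)) < cs.length (wI * z) := by
      have hw' := hz.forth _ hwI.1
      have e : wI * z = z * (z⁻¹ * wI * z) := by group
      have hl := hz.len _ hw'
      have e2 : z * (z⁻¹ * wI * z) * z⁻¹ = wI := by group
      rw [e2] at hl
      have h2 := hz.min _ hwI.1
      have h3 := cs.length_mul_le (cs.simple s * z) (z⁻¹ * wI * z)
      rw [mul_assoc, ← e] at h3
      omega
    obtain ⟨L, wL, z', hL, hwL, hz', hlt, hcons⟩ := good_step cs hI hwI hz hsI hdes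
    obtain ⟨m, E, hE, hpre⟩ := ih _ (hn ▸ hlt) L wL z' rfl hL hwL hz'
    obtain ⟨E', -, h2, h3⟩ := hcons m E hE hpre
    exact ⟨m + 1, E', h2, h3⟩

lemma good_of_core (cs : CoxeterSystem M W) {I J : Set B} (hJ : Finitary cs J)
    {y pbar wI : W} (hwI : IsLongest cs I wI) (hcore : IsCore cs I y J)
    (hmax : IsMaxOf cs (dcos cs I y J) pbar) : Good cs I J (wI * pbar) := by
  obtain ⟨hl, hr⟩ := hcore
  obtain ⟨hp, hmax⟩ := hmax
  obtain ⟨wJ, hwJ⟩ := exists_longest cs hJ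
  set D := dcos cs I y J with hD
  have Dl : ∀ d ∈ D, ∀ a ∈ par cs I, a * d ∈ D := by
    rintro d ⟨a', ha', b, hb, rfl⟩ a ha
    exact ⟨a * a', mul_mem ha ha', b, hb, by group⟩
  have Dr : ∀ d ∈ D, ∀ b ∈ par cs J, d * b ∈ D := by
    rintro d ⟨a', ha', b', hb', rfl⟩ b hb
    exact ⟨a', ha', b' * b, mul_mem hb' hb, by group⟩
  have quotL : ∀ d ∈ D, ∀ e ∈ D, e * d⁻¹ ∈ par cs I := by
    intro d hd e he
    rw [← hl] at hd he
    obtain ⟨a, ha, rfl⟩ := hd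
    obtain ⟨b, hb, rfl⟩ := he
    have : b * y * (a * y)⁻¹ = b * a⁻¹ := by group
    rw [this]; exact mul_mem hb (inv_mem ha)
  have quotR : ∀ d ∈ D, ∀ e ∈ D, d⁻¹ * e ∈ par cs J := by
    intro d hd e he
    rw [hr] at hd he
    obtain ⟨a, ha, rfl⟩ := hd
    obtain ⟨b, hb, rfl⟩ := he
    have : (y * a)⁻¹ * (y * b) = a⁻¹ * b := by group
    rw [this]; exact mul_mem (inv_mem ha) hb
  have dI : ∀ k ∈ I, cs.length (cs.simple k * pbar) < cs.length pbar := by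
    intro k hk
    have h1 := hmax _ (Dl _ hp _ (simple_mem_par cs hk))
    have h2 := cs.length_simple_mul_ne pbar k
    omega
  have dJ : ∀ k ∈ J, cs.length (cs.simple k * pbar⁻¹) < cs.length pbar⁻¹ := by
    intro k hk
    have h1 := hmax _ (Dr _ hp _ (simple_mem_par cs hk))
    have h2 := cs.length_mul_simple_ne pbar k
    have e : cs.simple k * pbar⁻¹ = (pbar * cs.simple k)⁻¹ := by simp
    rw [e, cs.length_inv, cs.length_inv]
    omega
  have minI := fun a (ha : a ∈ par cs I) => hwI.min_coset dI ha
  have minJ := fun a (ha : a ∈ par cs J) => hwJ.min_coset dJ ha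
  have hz : wI * pbar ∈ D := Dl _ hp _ hwI.1
  have hz' : pbar * wJ ∈ D := Dr _ hp _ hwJ.1
  have einv : wJ * pbar⁻¹ = (pbar * wJ)⁻¹ := by rw [mul_inv_rev, hwJ.inv_eq]
  rw [einv] at minJ
  have hzz : pbar * wJ = wI * pbar := by
    have h1 := minI _ (quotL _ hz _ hz')
    have h2 := minJ _ (quotR _ hz _ hz')
    rw [inv_mul_cancel_right] at h1
    rw [mul_assoc, mul_inv_cancel, mul_one, cs.length_inv, cs.length_inv (pbar * wJ)] at h2
    have h3 : cs.length (pbar * wJ * (wI * pbar)⁻¹) = 0 := by omega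
    rw [cs.length_eq_zero_iff] at h3
    exact mul_inv_eq_one.mp h3
  rw [hzz] at minJ
  refine ⟨minI, ?_, ?_, ?_⟩
  · intro b hb
    exact quotL _ hz _ (Dr _ hz _ hb)
  · intro b hb
    have h0 := quotL _ hz _ (Dr _ hz _ hb)
    have h1 := minI _ h0
    have h2 := minJ _ (inv_mem hb)
    rw [inv_mul_cancel_right] at h1
    rw [← mul_inv_rev, cs.length_inv, cs.length_inv, cs.length_inv] at h2
    omega
  · intro a ha
    have := quotR _ hz _ (Dl _ hz _ ha)
    rwa [← mul_assoc] at this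

theorem statement_6 (cs : CoxeterSystem M W) (I J : Set B)
    (hI : Finitary cs I) (hJ : Finitary cs J)
    (y pbar : W) (hcore : IsCore cs I y J)
    (hmax : IsMaxOf cs (dcos cs I y J) pbar)
    (s : B) (hsI : s ∉ I)
    (hdes : cs.length (cs.simple s * pbar) < cs.length pbar) :
    ∃ m : ℕ, 1 ≤ m ∧ ∃ E : RAtomExpr cs I J m, E.letter 1 = s ∧ E.x m = pbar := by
  obtain ⟨wI, hwI⟩ := exists_longest cs hI
  have hz := good_of_core cs hJ hwI hcore hmax
  have e : wI * (wI * pbar) = pbar := by rw [← mul_assoc, hwI.mul_self, one_mul]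
  obtain ⟨L, wL, z', hL, hwL, hz', -, hcons⟩ :=
    good_step cs hI hwI hz hsI (by rw [e]; exact hdes)
  obtain ⟨m, E, hE, hpre⟩ := good_expr cs s _ L wL z' rfl hL hwL hz'
  obtain ⟨E', h1, h2, -⟩ := hcons m E hE hpre
  exact ⟨m + 1, by omega, E', h1, h2.trans e⟩

end CoxeterAtoms
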